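/- (Example 2.) Let ψ(t)=3t², α=3/2, β=4/3, η=1/2, ξ=1/3, λ=μ=1, Δ₁ = ψ(1/2)−ψ(1) = −9/4, Δ₂ = ψ(1/3)−ψ(1) = −8/3. Let f(t,x,y) = cos t/√(625+t) + (e^{−t}/200) sin x + (1/300)·(y·|x|/(1+|x|)) and g(t,x,y) = e^{−2t}/(2√(1600+t)) + (1/270) sin x + (1/(3(60+t))) sin y. Then there exists at least one pair of continuous functions x,y:[0,1]→ℝ satisfying, for all t∈[0,1], x(t) = (1/Γ(3/2))∫₀ᵗ 6s(3t²−3s²)^{1/2} f(s,x(s),y(s)) ds + (1/Δ₁)[ (1/Γ(3/2))∫₀¹ 6s(3−3s²)^{1/2} f(s,x(s),y(s)) ds − (1/Γ(3/2))∫₀^{1/2} 6s(3/4−3s²)^{1/2} f(s,x(s),y(s)) ds ]·3t² and y(t) = (1/Γ(4/3))∫₀ᵗ 6s(3t²−3s²)^{1/3} g(s,x(s),y(s)) ds + (1/Δ₂)[ (1/Γ(4/3))∫₀¹ 6s(3−3s²)^{1/3} g(s,x(s),y(s)) ds − (1/Γ(4/3))∫₀^{1/3} 6s(1/3−3s²)^{1/3}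 g(s,x(s),y(s)) ds ]·3t². -/

import Mathlib

open MeasureTheory intervalIntegral Set Real

/-- The integral operator of the examples, with `ψ(t) = 3t²` (so `ψ'(s) = 6s` and
`ψ(t) − ψ(0) = 3t²`): given the Gamma-argument `gα`, the exponent `e = gα − 1`, the
interior point `ηv`, its image `ηψ = ψ(ηv)`, and the constant `Δ`,
`Tex gα e ηv ηψ Δ F t = (1/Γ(gα)) ∫₀ᵗ 6s(3t²−3s²)^e F(s) ds
+ (1/Δ)[ (1/Γ(gα)) ∫₀¹ 6s(3−3s²)^e F(s) ds − (1/Γ(gα)) ∫₀^{ηv} 6s(ηψ−3s²)^e F(s) ds ]·3t²`. -/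
noncomputable def Tex (gα e ηv ηψ Δ : ℝ) (F : ℝ → ℝ) (t : ℝ) : ℝ :=
  (1 / Real.Gamma gα) * (∫ s in (0:ℝ)..t, 6 * s * (3 * t ^ 2 - 3 * s ^ 2) ^ e * F s)
  + (1 / Δ) *
      ((1 / Real.Gamma gα) * (∫ s in (0:ℝ)..1, 6 * s * (3 - 3 * s ^ 2) ^ e * F s)
        - (1 / Real.Gamma gα) * (∫ s in (0:ℝ)..ηv, 6 * s * (ηψ - 3 * s ^ 2) ^ e * F s))
    * (3 * t ^ 2)

/-- The kernel of `Tex` is jointly continuous for nonnegative exponents. -/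
lemma continuous_kernel {e : ℝ} (he : 0 ≤ e) :
    Continuous fun p : ℝ × ℝ => 6 * p.2 * (3 * p.1 ^ 2 - 3 * p.2 ^ 2) ^ e :=
  (by fun_prop : Continuous fun p : ℝ × ℝ => 6 * p.2).mul
    (Continuous.rpow_const (by fun_prop) fun _ => Or.inr he)

lemma rpow_le_two_of_le_three {b e : ℝ} (hb : 0 ≤ b) (hb' : b ≤ 3) (he : 0 ≤ e)
    (he' : e ≤ 1 / 2) : b ^ e ≤ 2 := by
  rcases le_total b 1 with h | h
  · exact (Real.rpow_le_one hb h he).trans (by norm_num)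
  · calc b ^ e ≤ b ^ (1 / 2 : ℝ) := Real.rpow_le_rpow_of_exponent_le h he'
      _ = √b := (Real.sqrt_eq_rpow b).symm
      _ ≤ 2 := Real.sqrt_le_iff.mpr ⟨by norm_num, by linarith⟩

lemma abs_kernel_integral_le {e t M : ℝ} {F : ℝ → ℝ} (he : 0 ≤ e) (he' : e ≤ 1 / 2)
    (ht : t ∈ Icc (0 : ℝ) 1) (hF : ∀ s ∈ Icc (0 : ℝ) 1, |F s| ≤ M) :
    |∫ s in (0:ℝ)..t, 6 * s * (3 * t ^ 2 - 3 * s ^ 2) ^ e * F s| ≤ 6 * t ^ 2 * M := by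
  have hM : ∫ s in (0:ℝ)..t, 12 * M * s = 6 * t ^ 2 * M := by
    rw [intervalIntegral.integral_const_mul, integral_id]; ring
  rw [← hM, ← Real.norm_eq_abs]
  refine intervalIntegral.norm_integral_le_of_norm_le ht.1 ?_
    (Continuous.intervalIntegrable (by fun_prop) _ _)
  refine Filter.Eventually.of_forall fun s hs => ?_
  have hst : s ^ 2 ≤ t ^ 2 := pow_le_pow_left₀ hs.1.le hs.2 2
  have hb : 0 ≤ 3 * t ^ 2 - 3 * s ^ 2 := by linarith
  have hb' : 3 * t ^ 2 - 3 * s ^ 2 ≤ 3 := by nlinarith [sq_nonneg s, ht.1, ht.2]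
  have hk := rpow_le_two_of_le_three hb hb' he he'
  have hk0 := Real.rpow_nonneg hb e
  have hFs := hF s ⟨hs.1.le, hs.2.trans ht.2⟩
  have hs0 : 0 ≤ 6 * s := by linarith [hs.1]
  rw [Real.norm_eq_abs, abs_mul, abs_mul, abs_of_nonneg hs0, abs_of_nonneg hk0]
  calc 6 * s * (3 * t ^ 2 - 3 * s ^ 2) ^ e * |F s| ≤ 6 * s * 2 * M := by gcongr
    _ = 12 * M * s := by ring

/-- A lower bound for `Γ` left of its value at `2`, by convexity. -/
lemma sub_one_le_Gamma {a : ℝ} (ha : 0 < a) (ha2 : a ≤ 2) : a - 1 ≤ Real.Gamma a := by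
  have h3 : 0 < 3 - a := by linarith
  have hG3 : Real.Gamma 3 = 2 := by
    rw [← two_add_one_eq_three, Real.Gamma_add_one two_ne_zero, Real.Gamma_two, mul_one]
  have h := Real.convexOn_Gamma.2 (show a ∈ Ioi (0 : ℝ) from ha)
    (show (3 : ℝ) ∈ Ioi (0 : ℝ) by norm_num)
    (show 0 ≤ 1 / (3 - a) by positivity)
    (show 0 ≤ (2 - a) / (3 - a) from div_nonneg (by linarith) h3.le)
    (by field_simp; ring)
  have h2 : (1 / (3 - a)) • a + ((2 - a) / (3 - a)) • (3 : ℝ) = 2 := by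
    simp only [smul_eq_mul]; field_simp; ring
  rw [h2, Real.Gamma_two, hG3] at h
  simp only [smul_eq_mul] at h
  field_simp at h
  linarith

lemma abs_one_div_Gamma_le_three {a : ℝ} (ha : 4 / 3 ≤ a) (ha2 : a ≤ 2) :
    |1 / Real.Gamma a| ≤ 3 := by
  have h := sub_one_le_Gamma (by linarith) ha2
  have hp : 1 / 3 ≤ Real.Gamma a := by linarith
  rw [abs_of_nonneg (by positivity), div_le_iff₀ (by linarith)]
  linarith

section Tex

variable {a e η ηψ Δ : ℝ}

lemma continuous_Tex {F : ℝ → ℝ} (he : 0 ≤ e) (hF : Continuous F) :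
    Continuous (Tex a e η ηψ Δ F) := by
  have h : Continuous fun t : ℝ =>
      ∫ s in (0:ℝ)..t, 6 * s * (3 * t ^ 2 - 3 * s ^ 2) ^ e * F s :=
    intervalIntegral.continuous_parametric_intervalIntegral_of_continuous
      (f := fun t s => 6 * s * (3 * t ^ 2 - 3 * s ^ 2) ^ e * F s)
      (Continuous.fun_mul (continuous_kernel he) (hF.comp continuous_snd)) continuous_id
  unfold Tex
  fun_prop

lemma Tex_congr {F G : ℝ → ℝ} (hη : η ∈ Icc (0 : ℝ) 1) (h : EqOn F G (Icc 0 1)) {t : ℝ}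
    (ht : t ∈ Icc (0 : ℝ) 1) : Tex a e η ηψ Δ F t = Tex a e η ηψ Δ G t := by
  have key : ∀ r ∈ Icc (0 : ℝ) 1, ∀ k : ℝ → ℝ,
      ∫ s in (0:ℝ)..r, k s * F s = ∫ s in (0:ℝ)..r, k s * G s := fun r hr k =>
    intervalIntegral.integral_congr fun s hs => by
      rw [uIcc_of_le hr.1] at hs
      simp only [h ⟨hs.1, hs.2.trans hr.2⟩]
  simp only [Tex, key t ht, key 1 (by simp), key η hη]

lemma Tex_sub {F G : ℝ → ℝ} (he : 0 ≤ e) (hF : Continuous F) (hG : Continuous G) (t : ℝ) :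
    Tex a e η ηψ Δ F t - Tex a e η ηψ Δ G t = Tex a e η ηψ Δ (fun s => F s - G s) t := by
  have key : ∀ c r : ℝ, ∫ s in (0:ℝ)..r, 6 * s * (c - 3 * s ^ 2) ^ e * (F s - G s) =
      (∫ s in (0:ℝ)..r, 6 * s * (c - 3 * s ^ 2) ^ e * F s)
        - ∫ s in (0:ℝ)..r, 6 * s * (c - 3 * s ^ 2) ^ e * G s := by
    intro c r
    have hk : Continuous fun s : ℝ => 6 * s * (c - 3 * s ^ 2) ^ e :=
      (by fun_prop : Continuous fun s : ℝ => 6 * s).mul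
        (Continuous.rpow_const (by fun_prop) fun _ => Or.inr he)
    rw [← intervalIntegral.integral_sub ((hk.fun_mul hF).intervalIntegrable _ _)
      ((hk.fun_mul hG).intervalIntegrable _ _)]
    simp only [mul_sub]
  simp only [Tex, key]
  ring

lemma abs_Tex_le {F : ℝ → ℝ} {M t : ℝ} (ha : |1 / Real.Gamma a| ≤ 3) (he : 0 ≤ e)
    (he' : e ≤ 1 / 2) (hη : 0 ≤ η) (hη' : η ≤ 1 / 2) (hψ : ηψ = 3 * η ^ 2)
    (hΔ : |1 / Δ| ≤ 4 / 9) (hF : ∀ s ∈ Icc (0 : ℝ) 1, |F s| ≤ M) (ht : t ∈ Icc (0 : ℝ) 1) :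
    |Tex a e η ηψ Δ F t| ≤ 48 * M := by
  subst hψ
  have hM : 0 ≤ M := (abs_nonneg _).trans (hF t ht)
  have bt := abs_kernel_integral_le he he' ht hF
  have b1 := abs_kernel_integral_le he he' (t := 1) (by simp) hF
  have bη := abs_kernel_integral_le he he' (t := η) ⟨hη, by linarith⟩ hF
  have ht2 : t ^ 2 ≤ 1 := by nlinarith [ht.1, ht.2]
  have hη2 : η ^ 2 ≤ 1 / 4 := by nlinarith
  simp only [one_pow, mul_one] at b1
  replace bt := bt.trans (show 6 * t ^ 2 * M ≤ 6 * M by nlinarith)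
  replace bη := bη.trans (show 6 * η ^ 2 * M ≤ 3 / 2 * M by nlinarith)
  unfold Tex
  generalize (∫ s in (0:ℝ)..t, 6 * s * (3 * t ^ 2 - 3 * s ^ 2) ^ e * F s) = A at *
  generalize (∫ s in (0:ℝ)..1, 6 * s * (3 - 3 * s ^ 2) ^ e * F s) = B at *
  generalize (∫ s in (0:ℝ)..η, 6 * s * (3 * η ^ 2 - 3 * s ^ 2) ^ e * F s) = C at *
  generalize 1 / Real.Gamma a = c at *
  generalize 1 / Δ = d at *
  have hBC : |c * B - c * C| ≤ 3 * (6 * M + 3 / 2 * M) := by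
    rw [← mul_sub, abs_mul]
    have := (abs_sub B C).trans (add_le_add b1 bη)
    gcongr
  calc |c * A + d * (c * B - c * C) * (3 * t ^ 2)|
      ≤ |c| * |A| + |d| * |c * B - c * C| * (3 * t ^ 2) := by
        refine (abs_add_le _ _).trans (le_of_eq ?_)
        rw [abs_mul, abs_mul, abs_mul d, abs_of_nonneg (by positivity : 0 ≤ 3 * t ^ 2)]
    _ ≤ 3 * (6 * M) + 4 / 9 * (3 * (6 * M + 3 / 2 * M)) * (3 * 1) := by gcongr
    _ = 48 * M := by ring

end Tex

/-- Existence of a solution for globally Lipschitz nonlinearities, by the contraction principle. -/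
lemma exists_solution_of_lipschitz {f g : ℝ → ℝ → ℝ → ℝ}
    (hf : Continuous fun p : ℝ × ℝ × ℝ => f p.1 p.2.1 p.2.2)
    (hg : Continuous fun p : ℝ × ℝ × ℝ => g p.1 p.2.1 p.2.2)
    (hfL : ∀ t u v u' v' D : ℝ, |u - u'| ≤ D → |v - v'| ≤ D →
      |f t u v - f t u' v'| ≤ 3 / 200 * D)
    (hgL : ∀ t u v u' v' D : ℝ, |u - u'| ≤ D → |v - v'| ≤ D →
      |g t u v - g t u' v'| ≤ 3 / 200 * D) :
    ∃ x y : ℝ → ℝ, Continuous x ∧ Continuous y ∧ ∀ t ∈ Icc (0:ℝ) 1,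
      x t = Tex (3/2) (1/2) (1/2) (3/4) (-(9/4)) (fun s => f s (x s) (y s)) t ∧
      y t = Tex (4/3) (1/3) (1/3) (1/3) (-(8/3)) (fun s => g s (x s) (y s)) t := by
  let E := C(Icc (0 : ℝ) 1, ℝ)
  let ext : E → ℝ → ℝ := fun u => IccExtend zero_le_one u
  have ext_cont : ∀ u : E, Continuous (ext u) := fun u => u.continuous.Icc_extend'
  have comp_cont : ∀ {h : ℝ → ℝ → ℝ → ℝ},
      (Continuous fun p : ℝ × ℝ × ℝ => h p.1 p.2.1 p.2.2) → ∀ p : E × E,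
      Continuous fun s => h s (ext p.1 s) (ext p.2 s) := fun hh p =>
    hh.comp (continuous_id.prodMk ((ext_cont p.1).prodMk (ext_cont p.2)))
  have ext_dist : ∀ u v : E, ∀ s, |ext u s - ext v s| ≤ dist u v := fun u v s => by
    rw [← Real.dist_eq]
    exact ContinuousMap.dist_apply_le_dist _
  let Φ : E × E → E × E := fun p =>
    (⟨fun t => Tex (3/2) (1/2) (1/2) (3/4) (-(9/4)) (fun s => f s (ext p.1 s) (ext p.2 s)) t,
      (continuous_Tex (by norm_num) (comp_cont hf p)).comp continuous_subtype_val⟩,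
     ⟨fun t => Tex (4/3) (1/3) (1/3) (1/3) (-(8/3)) (fun s => g s (ext p.1 s) (ext p.2 s)) t,
      (continuous_Tex (by norm_num) (comp_cont hg p)).comp continuous_subtype_val⟩)
  have hΦ : ContractingWith (3 / 4) Φ := by
    refine ⟨by rw [← NNReal.coe_lt_coe]; norm_num, LipschitzWith.of_dist_le_mul fun p q => ?_⟩
    have h1 : ∀ s, |ext p.1 s - ext q.1 s| ≤ dist p q := fun s =>
      (ext_dist _ _ s).trans (le_max_left _ _)
    have h2 : ∀ s, |ext p.2 s - ext q.2 s| ≤ dist p q := fun s =>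
      (ext_dist _ _ s).trans (le_max_right _ _)
    have hD : 0 ≤ dist p q := dist_nonneg
    have hc : ((3 / 4 : NNReal) : ℝ) * dist p q = 3 / 4 * dist p q := by norm_num
    rw [hc]
    refine max_le ?_ ?_
    · refine (ContinuousMap.dist_le (by positivity)).mpr fun t => ?_
      rw [Real.dist_eq]
      change |Tex _ _ _ _ _ _ _ - Tex _ _ _ _ _ _ _| ≤ _
      rw [Tex_sub (by norm_num) (comp_cont hf p) (comp_cont hf q)]
      refine (abs_Tex_le (M := 3 / 200 * dist p q) (abs_one_div_Gamma_le_three ?_ ?_) ?_ ?_ ?_ ?_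
        ?_ ?_ (fun s _ => hfL _ _ _ _ _ _ (h1 s) (h2 s)) t.2).trans (by linarith)
      all_goals norm_num [abs_of_pos]
    · refine (ContinuousMap.dist_le (by positivity)).mpr fun t => ?_
      rw [Real.dist_eq]
      change |Tex _ _ _ _ _ _ _ - Tex _ _ _ _ _ _ _| ≤ _
      rw [Tex_sub (by norm_num) (comp_cont hg p) (comp_cont hg q)]
      refine (abs_Tex_le (M := 3 / 200 * dist p q) (abs_one_div_Gamma_le_three ?_ ?_) ?_ ?_ ?_ ?_
        ?_ ?_ (fun s _ => hgL _ _ _ _ _ _ (h1 s) (h2 s)) t.2).trans (by linarith)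
      all_goals norm_num [abs_of_pos]
  have hfix : Φ hΦ.fixedPoint = hΦ.fixedPoint := hΦ.fixedPoint_isFixedPt
  refine ⟨ext hΦ.fixedPoint.1, ext hΦ.fixedPoint.2, ext_cont _, ext_cont _, fun t ht => ⟨?_, ?_⟩⟩
  · exact (IccExtend_of_mem zero_le_one _ ht).trans
      (DFunLike.congr_fun (congrArg Prod.fst hfix) ⟨t, ht⟩).symm
  · exact (IccExtend_of_mem zero_le_one _ ht).trans
      (DFunLike.congr_fun (congrArg Prod.snd hfix) ⟨t, ht⟩).symm

lemma abs_div_one_add_abs_sub_le (u v : ℝ) :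
    abs (|u| / (1 + |u|) - |v| / (1 + |v|)) ≤ |u - v| := by
  have hu := abs_nonneg u
  have hv := abs_nonneg v
  have h : |u| / (1 + |u|) - |v| / (1 + |v|) = (|u| - |v|) / ((1 + |u|) * (1 + |v|)) := by
    field_simp; ring
  rw [h, abs_div, abs_of_pos (by positivity : 0 < (1 + |u|) * (1 + |v|))]
  exact (div_le_self (abs_nonneg _) (by nlinarith [mul_nonneg hu hv])).trans
    (abs_abs_sub_abs_le u v)

/-- The truncation of the real line to `[a, b]`. -/
noncomputable def clamp (a b t : ℝ) : ℝ := max a (min b t)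

lemma continuous_clamp (a b : ℝ) : Continuous (clamp a b) := by
  unfold clamp; fun_prop

lemma clamp_mem {a b : ℝ} (h : a ≤ b) (t : ℝ) : clamp a b t ∈ Icc a b :=
  ⟨le_max_left _ _, max_le h (min_le_left _ _)⟩

lemma clamp_of_mem {a b t : ℝ} (h : t ∈ Icc a b) : clamp a b t = t := by
  rw [clamp, min_eq_right h.2, max_eq_right h.1]

lemma abs_clamp_sub_le (a b u v : ℝ) : |clamp a b u - clamp a b v| ≤ |u - v| :=
  (abs_max_sub_max_le_max _ _ _ _).trans (by
    simpa using (abs_min_sub_min_le_max b u b v))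

/-- **Example 2 of the paper.**
With `ψ(t) = 3t²`, `α = 3/2`, `β = 4/3`, `η = 1/2`, `ξ = 1/3`, `λ = μ = 1`,
`Δ₁ = ψ(1/2) − ψ(1) = −9/4`, `Δ₂ = ψ(1/3) − ψ(1) = −8/3`,
`f(t,x,y) = cos t/√(625+t) + (e^{−t}/200) sin x + (1/300) y|x|/(1+|x|)` and
`g(t,x,y) = e^{−2t}/(2√(1600+t)) + (1/270) sin x + (1/(3(60+t))) sin y`, the coupled
system of integral equations has at least one pair of continuous solutions on `[0,1]`. -/
theorem example_two_existence
    (f g : ℝ → ℝ → ℝ → ℝ)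
    (hf : ∀ t u v : ℝ, f t u v =
      Real.cos t / Real.sqrt (625 + t) + (Real.exp (-t) / 200) * Real.sin u
        + (1 / 300) * (v * |u| / (1 + |u|)))
    (hg : ∀ t u v : ℝ, g t u v =
      Real.exp (-2 * t) / (2 * Real.sqrt (1600 + t)) + (1 / 270) * Real.sin u
        + (1 / (3 * (60 + t))) * Real.sin v) :
    ∃ x y : ℝ → ℝ,
      ContinuousOn x (Icc 0 1) ∧ ContinuousOn y (Icc 0 1) ∧
      ∀ t ∈ Icc (0:ℝ) 1,
        x t = Tex (3/2) (1/2) (1/2) (3/4) (-(9/4)) (fun s => f s (x s) (y s)) t ∧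
        y t = Tex (4/3) (1/3) (1/3) (1/3) (-(8/3)) (fun s => g s (x s) (y s)) t := by
  have hc01 := clamp_mem (zero_le_one (α := ℝ))
  have hc2 := clamp_mem (show (-2 : ℝ) ≤ 2 by norm_num)
  have hφ : ∀ u : ℝ, 0 ≤ |u| / (1 + |u|) ∧ |u| / (1 + |u|) ≤ 1 := fun u =>
    ⟨by positivity, (div_le_one (by positivity)).mpr (by linarith)⟩
  have hfc : Continuous fun p : ℝ × ℝ × ℝ =>
      f (clamp 0 1 p.1) p.2.1 (clamp (-2) 2 p.2.2) := by
    have hp : ∀ t, √(625 + clamp 0 1 t) ≠ 0 := fun t =>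
      (Real.sqrt_pos.mpr (by linarith [(hc01 t).1])).ne'
    have hq : ∀ u : ℝ, 1 + |u| ≠ 0 := fun u => by positivity
    have := continuous_clamp 0 1
    have := continuous_clamp (-2) 2
    simp only [hf]
    fun_prop (disch := first | exact fun _ => hp _ | exact fun _ => hq _)
  have hgc : Continuous fun p : ℝ × ℝ × ℝ => g (clamp 0 1 p.1) p.2.1 p.2.2 := by
    have hp : ∀ t, 2 * √(1600 + clamp 0 1 t) ≠ 0 := fun t =>
      mul_ne_zero two_ne_zero (Real.sqrt_pos.mpr (by linarith [(hc01 t).1])).ne'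
    have hq : ∀ t, 3 * (60 + clamp 0 1 t) ≠ 0 := fun t => by
      have := (hc01 t).1; positivity
    have := continuous_clamp 0 1
    simp only [hg]
    fun_prop (disch := first | exact fun _ => hp _ | exact fun _ => hq _)
  have hfL : ∀ t u v u' v' D : ℝ, |u - u'| ≤ D → |v - v'| ≤ D →
      |f (clamp 0 1 t) u (clamp (-2) 2 v) - f (clamp 0 1 t) u' (clamp (-2) 2 v')|
        ≤ 3 / 200 * D := by
    intro t u v u' v' D hu hv
    have hD : 0 ≤ D := (abs_nonneg _).trans hu
    have he : Real.exp (-clamp 0 1 t) ≤ 1 :=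
      Real.exp_le_one_iff.mpr (by linarith [(hc01 t).1])
    have hs := (Real.abs_sin_sub_sin_le u u').trans hu
    have hw := (abs_clamp_sub_le (-2) 2 v v').trans hv
    have hd := (abs_div_one_add_abs_sub_le u u').trans hu
    have hw2 := abs_le.mpr (hc2 v)
    have hφ' := hφ u'
    simp only [hf, mul_div_assoc]
    generalize clamp (-2) 2 v = w at *
    generalize clamp (-2) 2 v' = w' at *
    generalize |u| / (1 + |u|) = a at *
    generalize |u'| / (1 + |u'|) = a' at *
    have h1 : |Real.exp (-clamp 0 1 t) / 200 * (Real.sin u - Real.sin u')| ≤ 1 / 200 * D := by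
      rw [abs_mul, abs_of_pos (by positivity)]
      gcongr
    have h2 : |w * (a - a')| ≤ 2 * D := by
      rw [abs_mul]; gcongr
    have h3 : |(w - w') * a'| ≤ D * 1 := by
      rw [abs_mul, abs_of_nonneg hφ'.1]
      exact mul_le_mul hw hφ'.2 hφ'.1 hD
    rw [abs_le] at h1 h2 h3 ⊢
    constructor <;> linarith
  have hgL : ∀ t u v u' v' D : ℝ, |u - u'| ≤ D → |v - v'| ≤ D →
      |g (clamp 0 1 t) u v - g (clamp 0 1 t) u' v'| ≤ 3 / 200 * D := by
    intro t u v u' v' D hu hv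
    have hs := (Real.abs_sin_sub_sin_le u u').trans hu
    have hs' := (Real.abs_sin_sub_sin_le v v').trans hv
    have hD : 0 ≤ D := (abs_nonneg _).trans hu
    have ht := (hc01 t).1
    have h60 : 1 / (3 * (60 + clamp 0 1 t)) ≤ 1 / 180 :=
      one_div_le_one_div_of_le (by norm_num) (by linarith)
    have h1 : |1 / (3 * (60 + clamp 0 1 t)) * (Real.sin v - Real.sin v')| ≤ 1 / 180 * D := by
      rw [abs_mul, abs_of_nonneg (by positivity)]
      gcongr
    simp only [hg]
    rw [abs_le] at h1 hs ⊢
    constructor <;> linarith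
  obtain ⟨x, y, hx, hy, hxy⟩ := exists_solution_of_lipschitz
    (f := fun t u v => f (clamp 0 1 t) u (clamp (-2) 2 v))
    (g := fun t u v => g (clamp 0 1 t) u v) hfc hgc hfL hgL
  have hcoef : ∀ s ∈ Icc (0 : ℝ) 1, ∀ u v, |g s u v| ≤ 1 / 24 := by
    intro s hs u v
    have hsq : 40 ≤ √(1600 + s) := Real.le_sqrt_of_sq_le (by linarith [hs.1])
    have h1 : |Real.exp (-2 * s) / (2 * √(1600 + s))| ≤ 1 / 80 := by
      rw [abs_of_nonneg (by positivity), div_le_div_iff₀ (by positivity) (by norm_num)]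
      have := Real.exp_le_one_iff.mpr (show -2 * s ≤ 0 by linarith [hs.1])
      linarith
    have h2 : |1 / 270 * Real.sin u| ≤ 1 / 270 := by
      rw [abs_mul, abs_of_pos (by norm_num)]
      linarith [Real.abs_sin_le_one u]
    have h3 : |1 / (3 * (60 + s)) * Real.sin v| ≤ 1 / 180 := by
      have h60 : 1 / (3 * (60 + s)) ≤ 1 / 180 :=
        one_div_le_one_div_of_le (by norm_num) (by linarith [hs.1])
      have h0 : 0 ≤ 1 / (3 * (60 + s)) := by have := hs.1; positivity
      rw [abs_mul, abs_of_nonneg h0]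
      nlinarith [Real.abs_sin_le_one v, abs_nonneg (Real.sin v)]
    rw [hg]
    exact (abs_add_three _ _ _).trans (by linarith)
  have hyb : ∀ t ∈ Icc (0 : ℝ) 1, y t ∈ Icc (-2 : ℝ) 2 := by
    intro t ht
    rw [mem_Icc, ← abs_le, (hxy t ht).2]
    refine (abs_Tex_le (M := 1 / 24) (abs_one_div_Gamma_le_three ?_ ?_) ?_ ?_ ?_ ?_
      ?_ ?_ (fun s _ => hcoef _ (hc01 s) _ _) ht).trans (by norm_num)
    all_goals norm_num [abs_of_pos]
  refine ⟨x, y, hx.continuousOn, hy.continuousOn, fun t ht => ⟨?_, ?_⟩⟩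
  · refine (hxy t ht).1.trans (Tex_congr (by norm_num) (fun s hs => ?_) ht)
    simp only [clamp_of_mem hs, clamp_of_mem (hyb s hs)]
  · refine (hxy t ht).2.trans (Tex_congr (by norm_num) (fun s hs => ?_) ht)
    simp only [clamp_of_mem hs]
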